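/- Let q = 2^t for a positive integer t. For any choice of the set Y, every χ_ℓ with ℓ ∈ L \ {ℓ0} lies in the F_2-span of X0 ∪ Y ∪ {χ_m : m ∈ L1}, and the all-ones function 1 on P also lies in this span. -/

import Mathlib

open Submodule Module
open scoped Classical

noncomputable section

variable (k : Type) [Field k] [Fintype k]

/-- The nonsingular alternating bilinear form on `k^4`. -/
def B (u v : Fin 4 → k) : k := u 0 * v 3 - u 3 * v 0 + u 1 * v 2 - u 2 * v 1

/-- Points of the projective space: 1-dimensional subspaces of `k^4`. -/
def IsPt (p : Submodule k (Fin 4 → k)) : Prop := finrank k p = 1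

/-- Lines: totally isotropic 2-dimensional subspaces of `k^4`. -/
def IsLn (l : Submodule k (Fin 4 → k)) : Prop :=
  finrank k l = 2 ∧ ∀ u ∈ l, ∀ v ∈ l, B k u v = 0

/-- The point set `P`. -/
abbrev Pt := {p : Submodule k (Fin 4 → k) // IsPt k p}

def e (i : Fin 4) : Fin 4 → k := Pi.single i 1

/-- The fixed point `p0 = span{e0}`. -/
def p0 : Submodule k (Fin 4 → k) := span k {e k 0}

/-- The fixed line `ℓ0 = span{e0, e1}`. -/
def l0 : Submodule k (Fin 4 → k) := span k {e k 0, e k 1}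

/-- Membership in `P1`: points `span{v}` with `B(e0, v) ≠ 0`. -/
def InP1 (p : Pt k) : Prop := ∃ v ∈ (p : Submodule k (Fin 4 → k)), B k (e k 0) v ≠ 0

/-- The characteristic function of a line, as an `F_2`-valued function on `P`. -/
def chi (l : Submodule k (Fin 4 → k)) : Pt k → ZMod 2 :=
  fun p => if (p : Submodule k (Fin 4 → k)) ≤ l then 1 else 0

/-- The set `L1` of lines meeting `ℓ0` only in `0`. -/
def L1 : Set (Submodule k (Fin 4 → k)) := {l | IsLn k l ∧ l ⊓ l0 k = ⊥}

/-- The code `C(P,L)`. -/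
def CPL : Submodule (ZMod 2) (Pt k → ZMod 2) := span (ZMod 2) (chi k '' {l | IsLn k l})

/-- The code `C(P,L1)`. -/
def CPL1 : Submodule (ZMod 2) (Pt k → ZMod 2) := span (ZMod 2) (chi k '' L1 k)

/-- Restriction of functions on `P` to `P1`. -/
def piP1 : (Pt k → ZMod 2) →ₗ[ZMod 2] ({p : Pt k // InP1 k p} → ZMod 2) :=
  LinearMap.funLeft (ZMod 2) (ZMod 2) Subtype.val

/-- The code `C(P1,L1)`, the image of `C(P,L1)` under restriction to `P1`. -/
def CP1L1 : Submodule (ZMod 2) ({p : Pt k // InP1 k p} → ZMod 2) := (CPL1 k).map (piP1 k)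

/-- `X0`: the characteristic functions of the lines through `p0`, except `χ_{ℓ0}`. -/
def X0 : Set (Pt k → ZMod 2) :=
  (chi k '' {l | IsLn k l ∧ p0 k ≤ l}) \ {chi k (l0 k)}

theorem choose_two_pow_mul_add_mod_two (r : ℕ) : ∀ M n : ℕ, n < 2 ^ r →
    (2 ^ r * M + (2 ^ r - 1)).choose n % 2 = 1 := by
  induction r with
  | zero => intro M n hn; simp at hn; simp [hn]
  | succ r ih =>
    intro M n hn
    have hp : 0 < 2 ^ r := by positivity
    have e1 : (2 ^ (r + 1) * M + (2 ^ (r + 1) - 1)) =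
        2 * (2 ^ r * M + (2 ^ r - 1)) + 1 := by
      rw [pow_succ, mul_right_comm]; omega
    have h := Choose.choose_modEq_choose_mod_mul_choose_div_nat
      (n := 2 * (2 ^ r * M + (2 ^ r - 1)) + 1) (k := n) (p := 2)
    have e2 : (2 * (2 ^ r * M + (2 ^ r - 1)) + 1) % 2 = 1 := by omega
    have e3 : (2 * (2 ^ r * M + (2 ^ r - 1)) + 1) / 2 = 2 ^ r * M + (2 ^ r - 1) := by omega
    have e4 : Nat.choose 1 (n % 2) = 1 := by
      rcases Nat.mod_two_eq_zero_or_one n with h | h <;> simp [h]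
    rw [e2, e3, e4, one_mul] at h
    rw [e1, h]
    exact ih M (n / 2) (by rw [pow_succ] at hn; omega)

theorem choose_two_pow_sub_two_mod_two (r n : ℕ) (hn : n < 2 ^ (r + 1)) :
    (2 ^ (r + 1) - 2).choose n % 2 = if Even n then 1 else 0 := by
  have h := Choose.choose_modEq_choose_mod_mul_choose_div_nat
      (n := 2 ^ (r + 1) - 2) (k := n) (p := 2)
  have e1 : (2 ^ (r + 1) - 2) % 2 = 0 := by rw [pow_succ]; omega
  have e2 : (2 ^ (r + 1) - 2) / 2 = 2 ^ r * 0 + (2 ^ r - 1) := by rw [pow_succ]; omega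
  rw [e1, e2] at h
  rw [h]
  split_ifs with hE
  · rw [Nat.even_iff.mp hE, Nat.choose_self, one_mul]
    exact choose_two_pow_mul_add_mod_two r 0 _ (by rw [pow_succ] at hn; omega)
  · rw [Nat.not_even_iff.mp hE]; simp

section CharTwoField

variable {K : Type} [Field K]

theorem natCast_eq_one_of_mod_two [CharP K 2] {n : ℕ} (h : n % 2 = 1) : (n : K) = 1 := by
  rw [CharP.cast_eq_mod K 2 n, h, Nat.cast_one]

theorem natCast_choose_two_pow_sub_two [CharP K 2] (r n : ℕ) (hn : n < 2 ^ (r + 1)) :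
    ((2 ^ (r + 1) - 2).choose n : K) = if Even n then 1 else 0 := by
  rw [CharP.cast_eq_mod K 2, choose_two_pow_sub_two_mod_two r n hn]
  split_ifs <;> simp

/-- A weight on the lines `{(a + b s, c + b s², s)}`, built to isolate the points with `s = 0`. -/
def lineWeight (t : ℕ) (a b c : K) : K :=
  c ^ (2 ^ t - 2) * a ^ (2 ^ t - 1) + ∑ r ∈ Finset.range t,
    c ^ (2 ^ t - 1 - 2 ^ r) * a ^ (2 ^ (r + 1) - 2) * b ^ (2 ^ t - 2 ^ r)

/-- The part of `∑ y ^ m * z ^ (q - 2 - m)` over even `m` in `[a, b)`. -/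
def evenSum (q : ℕ) (y z : K) (a b : ℕ) : K :=
  ∑ m ∈ Finset.Ico a b, if Even m then y ^ m * z ^ (q - 2 - m) else 0

theorem sum_evenSum (q : ℕ) (y z : K) (t : ℕ) :
    ∑ r ∈ Finset.range t, evenSum q y z (2 ^ r - 1) (2 ^ (r + 1) - 1) =
      evenSum q y z 0 (2 ^ t - 1) := by
  induction t with
  | zero => simp [evenSum]
  | succ t ih =>
    rw [Finset.sum_range_succ, ih]
    refine Finset.sum_Ico_consecutive _ (Nat.zero_le _) ?_
    rw [pow_succ]; omega

variable [Fintype K]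

open Polynomial in
theorem sum_eval_eq_neg_coeff (P : K[X]) (hP : P.natDegree < 2 * (Fintype.card K - 1)) :
    ∑ t : K, P.eval t = - P.coeff (Fintype.card K - 1) := by
  have hc : 1 < Fintype.card K := Fintype.one_lt_card
  simp_rw [eval_eq_sum_range' hP]
  rw [Finset.sum_comm]
  simp_rw [← Finset.mul_sum]
  rw [Finset.sum_eq_single (Fintype.card K - 1)]
  · have : ∑ x : K, x ^ (Fintype.card K - 1) = -1 := by
      have h : ∀ x : K, x ^ (Fintype.card K - 1) = 1 - if x = 0 then 1 else 0 := by
        intro x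
        split_ifs with hx
        · rw [hx, zero_pow (by omega)]; simp
        · rw [FiniteField.pow_card_sub_one_eq_one x hx]; simp
      simp_rw [h]
      simp
    rw [this]; ring
  · intro i hi hne
    rw [Finset.mem_range] at hi
    rcases lt_or_gt_of_ne hne with h | h
    · rw [FiniteField.sum_pow_lt_card_sub_one K i h, mul_zero]
    · obtain ⟨j, rfl⟩ : ∃ j, i = (Fintype.card K - 1) + j := ⟨i - (Fintype.card K - 1), by omega⟩
      have : ∀ x : K, x ^ (Fintype.card K - 1 + j) = x ^ j := by
        intro x
        by_cases hx : x = 0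
        · rw [hx, zero_pow (by omega), zero_pow (by omega)]
        · rw [pow_add, FiniteField.pow_card_sub_one_eq_one x hx, one_mul]
      simp_rw [this]
      rw [FiniteField.sum_pow_lt_card_sub_one K j (by omega), mul_zero]
  · intro h
    exact absurd (Finset.mem_range.mpr (by omega)) h

open Polynomial in
theorem sum_pow_mul_pow_mul_pow (y z : K) (a b d n : ℕ) (hd : n + d = Fintype.card K - 1)
    (hlt : a + b + d < 2 * (Fintype.card K - 1)) :
    ∑ t : K, (z + t) ^ a * (y + t) ^ b * t ^ d =
      - ∑ ij ∈ Finset.HasAntidiagonal.antidiagonal n,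
        (z ^ (a - ij.1) * (a.choose ij.1 : K)) * (y ^ (b - ij.2) * (b.choose ij.2 : K)) := by
  have h := sum_eval_eq_neg_coeff ((X + C z) ^ a * (X + C y) ^ b * X ^ d : K[X]) (by
    refine lt_of_le_of_lt ?_ hlt
    compute_degree)
  rw [← hd, coeff_mul_X_pow, coeff_mul] at h
  simp only [coeff_X_add_C_pow] at h
  rw [← h]
  refine Finset.sum_congr rfl fun t _ => ?_
  simp [add_comm]

theorem sum_lineWeight_third {t : ℕ} (ht : 0 < t) (hcard : Fintype.card K = 2 ^ t) (a b : K) :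
    ∑ c : K, lineWeight t a b c = 0 := by
  have h2 : 2 ≤ 2 ^ t := by
    calc 2 = 2 ^ 1 := rfl
      _ ≤ 2 ^ t := Nat.pow_le_pow_right (by norm_num) ht
  simp only [lineWeight]
  rw [Finset.sum_add_distrib, ← Finset.sum_mul,
    FiniteField.sum_pow_lt_card_sub_one K _ (by rw [hcard]; omega), zero_mul, zero_add,
    Finset.sum_comm]
  refine Finset.sum_eq_zero fun r hr => ?_
  have hr0 : 0 < 2 ^ r := by positivity
  rw [← Finset.sum_mul, ← Finset.sum_mul,
    FiniteField.sum_pow_lt_card_sub_one K _ (by rw [hcard]; omega), zero_mul, zero_mul]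

theorem lineWeight_scale {t : ℕ} (hcard : Fintype.card K = 2 ^ t) {s : K}
    (hs : s ≠ 0) (a x c : K) :
    lineWeight t a (x * s⁻¹) (s * c) = s⁻¹ * lineWeight t a x c := by
  have hq : s ^ (2 ^ t - 1) = 1 := by
    rw [← hcard]; exact FiniteField.pow_card_sub_one_eq_one s hs
  have key : ∀ j, 1 ≤ j → j < 2 ^ t → s ^ (2 ^ t - 1 - j) = s⁻¹ ^ j := by
    intro j h0 hj
    rw [inv_pow]
    refine eq_inv_of_mul_eq_one_left ?_
    rw [← pow_add]
    rwa [show 2 ^ t - 1 - j + j = 2 ^ t - 1 by omega]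
  have ht2 : 1 < 2 ^ t := by rw [← hcard]; exact Fintype.one_lt_card
  simp only [lineWeight, mul_add, Finset.mul_sum, mul_pow]
  congr 1
  · rw [show 2 ^ t - 2 = 2 ^ t - 1 - 1 by omega, key 1 le_rfl ht2]; ring
  · refine Finset.sum_congr rfl fun r hr => ?_
    have h1 : 2 ^ r < 2 ^ t := Nat.pow_lt_pow_right (by norm_num) (Finset.mem_range.mp hr)
    have hr0 : 1 ≤ 2 ^ r := Nat.one_le_two_pow
    rw [key _ hr0 h1]
    have : s⁻¹ ^ (2 ^ r) * s⁻¹ ^ (2 ^ t - 2 ^ r) = s⁻¹ := by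
      rw [← pow_add, show 2 ^ r + (2 ^ t - 2 ^ r) = (2 ^ t - 1) + 1 by omega, pow_succ, inv_pow, hq]
      simp
    calc _ = (s⁻¹ ^ (2 ^ r) * s⁻¹ ^ (2 ^ t - 2 ^ r)) * (c ^ (2 ^ t - 1 - 2 ^ r) *
          a ^ (2 ^ (r + 1) - 2) * x ^ (2 ^ t - 2 ^ r)) := by ring
      _ = _ := by rw [this]

variable [CharP K 2]

theorem sum_middle_term {t : ℕ} (hcard : Fintype.card K = 2 ^ t) (y z : K) (r : ℕ) (hr : r < t) :
    ∑ x : K, (z + x) ^ (2 ^ t - 1 - 2 ^ r) * (y + x) ^ (2 ^ (r + 1) - 2) * x ^ (2 ^ t - 2 ^ r) =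
      evenSum (2 ^ t) y z (2 ^ r - 1) (2 ^ (r + 1) - 1) := by
  obtain ⟨d, rfl⟩ : ∃ d, t = r + 1 + d := ⟨t - (r + 1), by omega⟩
  have hr0 : 0 < 2 ^ r := by positivity
  have hd0 : 0 < 2 ^ d := by positivity
  have hE : 2 ^ (r + 1 + d) = 2 ^ r * (2 * (2 ^ d - 1)) + 2 * 2 ^ r := by
    obtain ⟨c, hc⟩ : ∃ c, 2 ^ d = c + 1 := ⟨2 ^ d - 1, by omega⟩
    rw [pow_add, pow_succ, hc, Nat.add_sub_cancel]; ring
  generalize hM : 2 ^ r * (2 * (2 ^ d - 1)) = M at hE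
  rw [sum_pow_mul_pow_mul_pow y z _ _ _ (2 ^ r - 1) (by rw [hcard]; omega)
    (by rw [hcard, pow_succ 2 r]; omega), CharTwo.neg_eq, evenSum,
    Finset.Nat.sum_antidiagonal_eq_sum_range_succ_mk, Finset.sum_Ico_eq_sum_range]
  have hl : 2 ^ (r + 1) - 1 - (2 ^ r - 1) = (2 ^ r - 1).succ := by rw [pow_succ]; omega
  rw [hl]
  refine Finset.sum_congr rfl fun i hi => ?_
  rw [Finset.mem_range] at hi
  have h1 : ((2 ^ (r + 1 + d) - 1 - 2 ^ r).choose i : K) = 1 := by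
    apply natCast_eq_one_of_mod_two
    have : 2 ^ (r + 1 + d) - 1 - 2 ^ r = 2 ^ r * (2 * (2 ^ d - 1)) + (2 ^ r - 1) := by
      rw [hM]; omega
    rw [this]
    exact choose_two_pow_mul_add_mod_two r _ i (by omega)
  rw [h1, natCast_choose_two_pow_sub_two r _ (by rw [pow_succ]; omega)]
  have hp : Even (2 ^ r - 1 - i) ↔ Even (2 ^ r - 1 + i) := by
    rw [Nat.even_iff, Nat.even_iff]; omega
  simp only [hp]
  split_ifs
  · have e1 : 2 ^ (r + 1 + d) - 1 - 2 ^ r - i = 2 ^ (r + 1 + d) - 2 - (2 ^ r - 1 + i) := by omega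
    have e2 : 2 ^ (r + 1) - 2 - (2 ^ r - 1 - i) = 2 ^ r - 1 + i := by rw [pow_succ]; omega
    rw [e1, e2]; ring
  · simp

theorem sum_leading_term {t : ℕ} (ht : 0 < t) (hcard : Fintype.card K = 2 ^ t) (y z : K) :
    ∑ x : K, (z + x) ^ (2 ^ t - 2) * (y + x) ^ (2 ^ t - 1) =
      evenSum (2 ^ t) y z 0 (2 ^ t - 1) := by
  obtain ⟨n, rfl⟩ : ∃ n, t = n + 1 := ⟨t - 1, by omega⟩
  have hn0 : 0 < 2 ^ n := by positivity
  have hs := pow_succ 2 n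
  have h := sum_pow_mul_pow_mul_pow y z (2 ^ (n + 1) - 2) (2 ^ (n + 1) - 1) 0 (2 ^ (n + 1) - 1)
    (by rw [hcard]; rfl) (by rw [hcard]; omega)
  simp only [pow_zero, mul_one] at h
  rw [h, CharTwo.neg_eq, evenSum, Finset.Nat.sum_antidiagonal_eq_sum_range_succ_mk,
    Finset.sum_range_succ, Nat.Ico_zero_eq_range]
  rw [Nat.choose_eq_zero_of_lt (by omega : 2 ^ (n + 1) - 2 < 2 ^ (n + 1) - 1)]
  simp only [Nat.cast_zero, mul_zero, zero_mul, add_zero]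
  refine Finset.sum_congr rfl fun i hi => ?_
  rw [Finset.mem_range] at hi
  rw [natCast_choose_two_pow_sub_two n i (by omega)]
  have h1 : ((2 ^ (n + 1) - 1).choose (2 ^ (n + 1) - 1 - i) : K) = 1 := by
    apply natCast_eq_one_of_mod_two
    have := choose_two_pow_mul_add_mod_two (n + 1) 0 (2 ^ (n + 1) - 1 - i) (by omega)
    simpa using this
  have e1 : 2 ^ (n + 1) - 1 - (2 ^ (n + 1) - 1 - i) = i := by omega
  rw [h1, e1]
  split_ifs
  · ring
  · simp

theorem sum_lineWeight_pencil_one {t : ℕ} (ht : 0 < t) (hcard : Fintype.card K = 2 ^ t) (y z : K) :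
    ∑ x : K, lineWeight t (y + x) x (z + x) = 0 := by
  simp only [lineWeight]
  rw [Finset.sum_add_distrib, Finset.sum_comm, sum_leading_term ht hcard,
    Finset.sum_congr rfl fun r hr => sum_middle_term hcard y z r (Finset.mem_range.mp hr),
    sum_evenSum, CharTwo.add_self_eq_zero]

theorem sum_lineWeight_pencil {t : ℕ} (ht : 0 < t) (hcard : Fintype.card K = 2 ^ t) (y z s : K) :
    ∑ b : K, lineWeight t (y + b * s) b (z + b * s ^ 2) =
      if s = 0 then z ^ (2 ^ t - 2) else 0 := by
  split_ifs with hs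
  · subst hs
    have h2 : 2 ≤ 2 ^ t := by
      calc 2 = 2 ^ 1 := rfl
        _ ≤ 2 ^ t := Nat.pow_le_pow_right (by norm_num) ht
    have hK : ((2 ^ t : ℕ) : K) = 0 := by rw [← hcard]; exact FiniteField.cast_card_eq_zero K
    have hsum : ∑ x : K, x ^ (2 ^ t - 1) = 1 := by
      have h := sum_eval_eq_neg_coeff (Polynomial.X ^ (Fintype.card K - 1) : Polynomial K)
        (by rw [Polynomial.natDegree_X_pow, hcard]; omega)
      simpa [hcard, CharTwo.neg_eq] using h
    simp only [lineWeight, mul_zero, add_zero, ne_eq, OfNat.ofNat_ne_zero, not_false_eq_true,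
      zero_pow]
    rw [Finset.sum_add_distrib, Finset.sum_const, Finset.card_univ, hcard, nsmul_eq_mul, hK,
      zero_mul, zero_add, Finset.sum_comm, Finset.sum_eq_single 0]
    · rw [← Finset.mul_sum]
      simp only [pow_zero, zero_add, pow_one, Nat.sub_self, mul_one]
      rw [hsum, mul_one]; congr 1
    · intro r hr h0
      have h1 : 2 ^ r < 2 ^ t := Nat.pow_lt_pow_right (by norm_num) (Finset.mem_range.mp hr)
      have h3 : 2 ≤ 2 ^ r := by
        calc 2 = 2 ^ 1 := rfl
          _ ≤ 2 ^ r := Nat.pow_le_pow_right (by norm_num) (by omega)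
      rw [← Finset.mul_sum, FiniteField.sum_pow_lt_card_sub_one K _ (by rw [hcard]; omega), mul_zero]
    · intro h; exact absurd (Finset.mem_range.mpr ht) h
  · have h := sum_lineWeight_pencil_one ht hcard y (z * s⁻¹)
    have hb : ∑ b : K, lineWeight t (y + b * s) b (z + b * s ^ 2) =
        ∑ x : K, s⁻¹ * lineWeight t (y + x) x (z * s⁻¹ + x) := by
      refine Fintype.sum_equiv (Equiv.mulRight₀ s hs) _ _ fun b => ?_
      rw [← lineWeight_scale hcard hs]
      simp only [Equiv.mulRight₀_apply]
      congr 1 <;> field_simp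
    rw [hb, ← Finset.mul_sum, h, mul_zero]

theorem sum_mul_pow_eq_zero_of_even {t : ℕ} (ht : 0 < t) (hcard : Fintype.card K = 2 ^ t)
    {G : K → K} (hG : ∀ d, ∑ z : K, G z * (z + d) ^ (2 ^ t - 2) = 0)
    {n : ℕ} (hn : n ≤ 2 ^ t - 2) (he : Even n) : ∑ z : K, G z * z ^ n = 0 := by
  obtain ⟨m, rfl⟩ : ∃ m, t = m + 1 := ⟨t - 1, by omega⟩
  have hm0 : 0 < 2 ^ m := by positivity
  have hs := pow_succ 2 m
  have hd : ∀ z : K, ∑ d : K, d ^ (n + 1) * (z + d) ^ (2 ^ (m + 1) - 2) = z ^ n := by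
    intro z
    have h := sum_pow_mul_pow_mul_pow 0 z (2 ^ (m + 1) - 2) 0 (n + 1) (2 ^ (m + 1) - 2 - n)
      (by rw [hcard]; omega) (by rw [hcard]; omega)
    simp only [pow_zero, mul_one] at h
    rw [CharTwo.neg_eq, Finset.Nat.sum_antidiagonal_eq_sum_range_succ_mk,
      Finset.sum_range_succ, Finset.sum_eq_zero (s := Finset.range _)] at h
    · rw [Finset.sum_congr rfl fun d _ => mul_comm _ _, h,
        natCast_choose_two_pow_sub_two m _ (by omega)]
      have h1 : Even (2 ^ (m + 1) - 2 - n) := by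
        rw [Nat.even_iff] at he ⊢; omega
      have h2 : 2 ^ (m + 1) - 2 - (2 ^ (m + 1) - 2 - n) = n := by omega
      simp [h1, h2]
    · intro i hi
      rw [Finset.mem_range] at hi
      rw [Nat.choose_eq_zero_of_lt (by omega : 0 < 2 ^ (m + 1) - 2 - n - i)]
      simp
  simp_rw [← hd, Finset.mul_sum]
  rw [Finset.sum_comm]
  refine Finset.sum_eq_zero fun d _ => ?_
  rw [← mul_zero (d ^ (n + 1)), ← hG d, Finset.mul_sum]
  exact Finset.sum_congr rfl fun z _ => by ring

theorem sum_mul_pow_eq_zero {t : ℕ} (ht : 0 < t) (hcard : Fintype.card K = 2 ^ t)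
    {G : K → K} (hsq : ∀ z, G z ^ 2 = G z)
    (hG : ∀ d, ∑ z : K, G z * (z + d) ^ (2 ^ t - 2) = 0) (n : ℕ) :
    n ≤ 2 ^ t - 2 → ∑ z : K, G z * z ^ n = 0 := by
  induction n using Nat.strong_induction_on with
  | _ n ih =>
    intro hn
    rcases Nat.even_or_odd n with he | ho
    · exact sum_mul_pow_eq_zero_of_even ht hcard hG hn he
    · have hsum : (∑ z : K, G z * z ^ n) ^ 2 = ∑ z : K, G z * z ^ (2 * n) := by
        rw [CharTwo.sum_sq]
        refine Finset.sum_congr rfl fun z _ => ?_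
        rw [mul_pow, hsq, ← pow_mul, mul_comm n 2]
      refine pow_eq_zero_iff (two_ne_zero) |>.mp (hsum.trans ?_)
      by_cases h : 2 * n ≤ 2 ^ t - 2
      · exact sum_mul_pow_eq_zero_of_even ht hcard hG h (even_two_mul n)
      · have heven : 2 ^ t % 2 = 0 := Nat.even_iff.mp ((even_two).pow_of_ne_zero ht.ne')
        obtain ⟨j, hj⟩ : ∃ j, 2 * n = 2 ^ t - 1 + j := ⟨2 * n - (2 ^ t - 1), by omega⟩
        have hj0 : 0 < j := by omega
        rw [← ih j (by omega) (by omega)]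
        refine Finset.sum_congr rfl fun z _ => ?_
        by_cases hz : z = 0
        · rw [hz, zero_pow (by omega), zero_pow (by omega)]
        · rw [hj, pow_add, ← hcard, FiniteField.pow_card_sub_one_eq_one z hz, one_mul]

theorem eq_of_sum_mul_pow_eq_zero {t : ℕ} (hcard : Fintype.card K = 2 ^ t)
    {G : K → K} (hG : ∀ n ≤ 2 ^ t - 2, ∑ z : K, G z * z ^ n = 0) (z z' : K) : G z = G z' := by
  have hc : 1 < 2 ^ t := by rw [← hcard]; exact Fintype.one_lt_card
  have key : ∀ w, G w = ∑ x : K, G x * x ^ (2 ^ t - 1) := by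
    intro w
    have h1 : G w = ∑ x : K, G x * (1 - (x + w) ^ (2 ^ t - 1)) := by
      rw [Finset.sum_eq_single w]
      · rw [CharTwo.add_self_eq_zero, zero_pow (by omega)]; ring
      · intro x _ hx
        have : x + w ≠ 0 := fun h => hx (CharTwo.add_eq_zero.mp h)
        rw [← hcard, FiniteField.pow_card_sub_one_eq_one _ this]; ring
      · simp
    have h0 := hG 0 (Nat.zero_le _)
    simp only [pow_zero] at h0
    rw [h1]
    simp only [mul_sub, Finset.sum_sub_distrib, h0, zero_sub, add_pow, Finset.mul_sum,
      CharTwo.neg_eq]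
    rw [Finset.sum_comm, Finset.sum_range_succ, Finset.sum_eq_zero, zero_add]
    · exact Finset.sum_congr rfl fun x _ => by simp
    · intro n hn
      rw [Finset.mem_range] at hn
      rw [← mul_zero (w ^ (2 ^ t - 1 - n) * ((2 ^ t - 1).choose n : K)), ← hG n (by omega),
        Finset.mul_sum]
      exact Finset.sum_congr rfl fun x _ => by ring
  rw [key z, key z']

theorem fiber_sum_const {t : ℕ} (ht : 0 < t) (hcard : Fintype.card K = 2 ^ t)
    (F : K → K → K → K) (hsq : ∀ y z s, F y z s ^ 2 = F y z s)
    (hF : ∀ a b c c', ∑ s : K, F (a + b * s) (c + b * s ^ 2) s =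
      ∑ s : K, F (a + b * s) (c' + b * s ^ 2) s) (z z' : K) :
    ∑ y : K, F y z 0 = ∑ y : K, F y z' 0 := by
  refine eq_of_sum_mul_pow_eq_zero (G := fun z => ∑ y : K, F y z 0) hcard
    (sum_mul_pow_eq_zero ht hcard ?_ ?_) z z'
  · intro z
    simp only [CharTwo.sum_sq, hsq]
  · intro d
    have h1 : ∀ b s : K, ∑ z : K, ∑ y : K, F y z s * lineWeight t (y + b * s) b (z + d + b * s ^ 2)
        = ∑ c : K, ∑ a : K, F (a + b * s) (c + b * s ^ 2) s * lineWeight t a b (c + d) := by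
      intro b s
      refine Fintype.sum_equiv (Equiv.addRight (b * s ^ 2)) _ _ fun z => ?_
      refine Fintype.sum_equiv (Equiv.addRight (b * s)) _ _ fun y => ?_
      simp only [Equiv.coe_addRight, add_assoc, CharTwo.add_self_eq_zero, add_zero]
      rw [add_comm d]
    calc ∑ z : K, (∑ y : K, F y z 0) * (z + d) ^ (2 ^ t - 2)
        = ∑ s : K, ∑ z : K, ∑ y : K, F y z s *
            ∑ b : K, lineWeight t (y + b * s) b (z + d + b * s ^ 2) := by
          simp only [sum_lineWeight_pencil ht hcard]
          rw [Finset.sum_eq_single (0 : K) (f := fun s => ∑ z : K, ∑ y : K, F y z s *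
            if s = 0 then (z + d) ^ (2 ^ t - 2) else 0)]
          · simp [Finset.sum_mul]
          · intro s _ hs; simp [hs]
          · simp
      _ = ∑ b : K, ∑ s : K, ∑ c : K, ∑ a : K,
            F (a + b * s) (c + b * s ^ 2) s * lineWeight t a b (c + d) := by
          simp only [← h1, Finset.mul_sum]
          rw [Finset.sum_comm (s := (Finset.univ : Finset K)) (t := Finset.univ)
            (f := fun b s => ∑ z : K, ∑ y : K,
              F y z s * lineWeight t (y + b * s) b (z + d + b * s ^ 2))]
          refine Finset.sum_congr rfl fun s _ => ?_
          rw [Finset.sum_comm (s := (Finset.univ : Finset K)) (t := Finset.univ)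
            (f := fun b z => ∑ y : K,
              F y z s * lineWeight t (y + b * s) b (z + d + b * s ^ 2))]
          refine Finset.sum_congr rfl fun z _ => ?_
          exact Finset.sum_comm
      _ = ∑ b : K, ∑ a : K, ∑ c : K,
            (∑ s : K, F (a + b * s) (0 + b * s ^ 2) s) * lineWeight t a b (c + d) := by
          refine Finset.sum_congr rfl fun b _ => ?_
          rw [Finset.sum_comm, Finset.sum_congr rfl fun c _ => Finset.sum_comm, Finset.sum_comm]
          refine Finset.sum_congr rfl fun a _ => Finset.sum_congr rfl fun c _ => ?_
          rw [← hF a b c 0, Finset.sum_mul]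
      _ = 0 := by
          refine Finset.sum_eq_zero fun b _ => Finset.sum_eq_zero fun a _ => ?_
          rw [← Finset.mul_sum, Fintype.sum_equiv (Equiv.addRight d)
            (fun c => lineWeight t a b (c + d)) (lineWeight t a b) (fun _ => rfl), sum_lineWeight_third ht hcard, mul_zero]

end CharTwoField

section Geometry

/-- The indicator of the point `span {v}`, for `v ≠ 0`. -/
def ptInd (v : Fin 4 → k) : Pt k → ZMod 2 :=
  fun p => if (p : Submodule k (Fin 4 → k)) = span k {v} then 1 else 0

variable {k}

omit [Fintype k] in
theorem exists_eq_span_singleton (p : Pt k) :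
    ∃ w : Fin 4 → k, w ≠ 0 ∧ (p : Submodule k (Fin 4 → k)) = span k {w} := by
  have h : finrank k (p : Submodule k (Fin 4 → k)) = 1 := p.2
  obtain ⟨w, hw, hne⟩ := (Submodule.ne_bot_iff (p : Submodule k (Fin 4 → k))).mp (by
    intro h0; rw [h0, finrank_bot] at h; exact absurd h (by norm_num))
  refine ⟨w, hne, (Submodule.eq_of_le_of_finrank_eq ?_ ?_).symm⟩
  · rwa [span_singleton_le_iff_mem]
  · rw [h, finrank_span_singleton hne]

omit [Fintype k] in
theorem chi_eq_add_sum {ι : Type} [Fintype ι] {W W' : Submodule k (Fin 4 → k)}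
    (T : ι → Fin 4 → k) (hW : W ≤ W') (hT : ∀ i, T i ∈ W') (hTW : ∀ i, T i ∉ W)
    (hex : ∀ w ∈ W', w ∉ W → ∃ (c : k) (i : ι), w = c • T i)
    (huniq : ∀ (i j : ι) (c : k), T i = c • T j → i = j) :
    chi k W' = chi k W + ∑ i, ptInd k (T i) := by
  ext p
  obtain ⟨w, hw0, hw⟩ := exists_eq_span_singleton p
  simp only [chi, ptInd, Pi.add_apply, Finset.sum_apply, hw, span_singleton_le_iff_mem]
  by_cases h1 : w ∈ W
  · have : ∀ i, span k {w} ≠ span k {T i} := by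
      intro i h
      refine hTW i ?_
      rw [← span_singleton_le_iff_mem, ← h, span_singleton_le_iff_mem]
      exact h1
    simp [h1, hW h1, this]
  · by_cases h2 : w ∈ W'
    · obtain ⟨c, i, hi⟩ := hex w h2 h1
      have hc : c ≠ 0 := by rintro rfl; exact hw0 (by simpa using hi)
      have hsp : ∀ j, span k {w} = span k {T j} ↔ j = i := by
        intro j
        constructor
        · intro h
          have : T j ∈ span k {w} := by rw [h]; exact mem_span_singleton_self _
          obtain ⟨d, hd⟩ := mem_span_singleton.mp this
          exact huniq j i (d * c) (by rw [← hd, hi, smul_smul])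
        · rintro rfl
          rw [hi, span_singleton_smul_eq (IsUnit.mk0 c hc)]
      simp [h1, h2, hsp]
    · have : ∀ i, span k {w} ≠ span k {T i} := by
        intro i h
        refine h2 ?_
        have hle : span k {T i} ≤ W' := by
          rw [span_singleton_le_iff_mem]; exact hT i
        exact hle (h ▸ mem_span_singleton_self w)
      simp [h1, h2, this]

omit [Fintype k] in
theorem chi_span_singleton {u : Fin 4 → k} (hu : u ≠ 0) : chi k (span k {u}) = ptInd k u := by
  have h := chi_eq_add_sum (W := ⊥) (W' := span k {u}) (fun _ : Unit => u) bot_le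
    (fun _ => mem_span_singleton_self u) (fun _ => by simpa using hu)
    (fun w hw _ => by
      obtain ⟨c, hc⟩ := mem_span_singleton.mp hw
      exact ⟨c, (), hc.symm⟩) (fun _ _ _ _ => rfl)
  have h0 : chi k (⊥ : Submodule k (Fin 4 → k)) = 0 := by
    ext p
    obtain ⟨w, hw0, hw⟩ := exists_eq_span_singleton p
    simp [chi, hw, hw0]
  simpa [h0] using h

theorem chi_span_pair {u v : Fin 4 → k} (hu : u ≠ 0) (hv : v ∉ span k {u}) :
    chi k (span k {u, v}) = ptInd k u + ∑ s : k, ptInd k (v + s • u) := by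
  rw [← chi_span_singleton hu]
  have hmem : ∀ s c : k, c • v + s • u ∈ span k {u} → c = 0 := by
    intro s c h
    by_contra hc
    refine hv ?_
    have h' : c • v ∈ span k {u} :=
      (Submodule.add_mem_iff_left _ (smul_mem _ _ (mem_span_singleton_self u))).mp h
    exact (Submodule.smul_mem_iff _ hc).mp h'
  refine chi_eq_add_sum _ (span_mono (by simp)) (fun s => ?_) (fun s h => ?_) ?_ ?_
  · exact mem_span_pair.mpr ⟨s, 1, by rw [one_smul, add_comm]⟩
  · exact one_ne_zero (hmem s 1 (by rwa [one_smul]))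
  · intro w hw hwu
    obtain ⟨a, b, rfl⟩ := mem_span_pair.mp hw
    have hb : b ≠ 0 := by
      rintro rfl
      exact hwu (by simpa using smul_mem _ a (mem_span_singleton_self u))
    refine ⟨b, b⁻¹ * a, ?_⟩
    rw [smul_add, smul_smul, mul_inv_cancel_left₀ hb, add_comm]
  · intro s s' c h
    have h1 : (1 - c) • v + (s - c * s') • u = 0 := by
      rw [sub_smul, sub_smul, one_smul, mul_smul]
      rw [smul_add] at h
      linear_combination (exp := 1) h
    have hc : (1 : k) - c = 0 := hmem (s - c * s') _ (by rw [h1]; exact zero_mem _)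
    rw [hc, zero_smul, zero_add, smul_eq_zero, or_iff_left hu] at h1
    linear_combination h1 - s' * hc

omit [Fintype k] in
theorem isLn_span_pair {u v : Fin 4 → k} (hu : u ≠ 0) (hv : v ∉ span k {u}) (hB : B k u v = 0) :
    IsLn k (span k {u, v}) := by
  constructor
  · have hli : LinearIndependent k ![u, v] := by
      rw [LinearIndependent.pair_iff' hu]
      exact fun a h => hv (mem_span_singleton.mpr ⟨a, h⟩)
    have := finrank_span_eq_card hli
    rwa [Matrix.range_cons, Matrix.range_cons, Matrix.range_empty, Set.union_empty,
      Set.singleton_union, Fintype.card_fin] at this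
  · intro x hx y hy
    obtain ⟨a, b, rfl⟩ := mem_span_pair.mp hx
    obtain ⟨c, d, rfl⟩ := mem_span_pair.mp hy
    simp only [B, Pi.add_apply, Pi.smul_apply, smul_eq_mul] at hB ⊢
    linear_combination (a * d - b * c) * hB

omit [Fintype k] in
theorem mem_l0_iff {w : Fin 4 → k} : w ∈ l0 k ↔ w 2 = 0 ∧ w 3 = 0 := by
  rw [l0, mem_span_pair]
  constructor
  · rintro ⟨a, b, rfl⟩; simp [e]
  · rintro ⟨h2, h3⟩
    refine ⟨w 0, w 1, ?_⟩
    ext i; fin_cases i <;> simp [e, h2, h3]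

omit [Fintype k] in
theorem finrank_l0 : finrank k (l0 k) = 2 := by
  refine (isLn_span_pair (u := e k 0) (v := e k 1) ?_ ?_ ?_).1
  · intro h; simpa [e] using congrFun h 0
  · intro h
    obtain ⟨a, ha⟩ := mem_span_singleton.mp h
    simpa [e] using congrFun ha 1
  · simp [B, e]

omit [Fintype k] in
theorem chi_injective : Function.Injective (chi k) := by
  have key : ∀ l l' : Submodule k (Fin 4 → k), chi k l = chi k l' → l ≤ l' := by
    intro l l' h w hw
    by_cases hw0 : w = 0
    · rw [hw0]; exact zero_mem _
    · have := congrFun h ⟨span k {w}, finrank_span_singleton hw0⟩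
      simpa [chi, hw] using this
  exact fun l l' h => le_antisymm (key l l' h) (key l' l h.symm)

/-- The totally isotropic line spanned by `(a, b, 1, 0)` and `(c, a, 0, 1)`. -/
def skewLine (a b c : k) : Submodule k (Fin 4 → k) := span k {![a, b, 1, 0], ![c, a, 0, 1]}

/-- In characteristic two, a totally isotropic line through the point `(β, 1, 0, 0)`. -/
def secantLine (β x : k) : Submodule k (Fin 4 → k) := span k {![β, 1, 0, 0], ![x, 0, β, 1]}

/-- A totally isotropic line through the point `(1, 0, 0, 0)`. -/
def baseLine (b : k) : Submodule k (Fin 4 → k) := span k {![1, 0, 0, 0], ![0, b, 1, 0]}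

omit [Fintype k] in
theorem skewLine_indep (a b c : k) :
    (![a, b, 1, 0] : Fin 4 → k) ≠ 0 ∧ (![c, a, 0, 1] : Fin 4 → k) ∉ span k {![a, b, 1, 0]} := by
  refine ⟨fun h => by simpa using congrFun h 2, fun h => ?_⟩
  obtain ⟨d, hd⟩ := mem_span_singleton.mp h
  simpa using congrFun hd 3

omit [Fintype k] in
theorem secantLine_indep (β x : k) :
    (![β, 1, 0, 0] : Fin 4 → k) ≠ 0 ∧ (![x, 0, β, 1] : Fin 4 → k) ∉ span k {![β, 1, 0, 0]} := by
  refine ⟨fun h => by simpa using congrFun h 1, fun h => ?_⟩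
  obtain ⟨d, hd⟩ := mem_span_singleton.mp h
  simpa using congrFun hd 3

omit [Fintype k] in
theorem baseLine_indep (b : k) :
    (![1, 0, 0, 0] : Fin 4 → k) ≠ 0 ∧ (![0, b, 1, 0] : Fin 4 → k) ∉ span k {![1, 0, 0, 0]} := by
  refine ⟨fun h => by simpa using congrFun h 0, fun h => ?_⟩
  obtain ⟨d, hd⟩ := mem_span_singleton.mp h
  simpa using congrFun hd 2

theorem chi_skewLine (a b c : k) : chi k (skewLine a b c) =
    ptInd k ![a, b, 1, 0] + ∑ s : k, ptInd k ![c + s * a, a + s * b, s, 1] := by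
  rw [skewLine, chi_span_pair (skewLine_indep a b c).1 (skewLine_indep a b c).2]
  simp

theorem chi_secantLine (β x : k) : chi k (secantLine β x) =
    ptInd k ![β, 1, 0, 0] + ∑ y : k, ptInd k ![x + y * β, y, β, 1] := by
  rw [secantLine, chi_span_pair (secantLine_indep β x).1 (secantLine_indep β x).2]
  simp

theorem chi_baseLine (b : k) : chi k (baseLine b) =
    ptInd k ![1, 0, 0, 0] + ∑ a : k, ptInd k ![a, b, 1, 0] := by
  rw [baseLine, chi_span_pair (baseLine_indep b).1 (baseLine_indep b).2]
  simp

theorem chi_l0 : chi k (l0 k) = ptInd k ![1, 0, 0, 0] + ∑ β : k, ptInd k ![β, 1, 0, 0] := by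
  have h : l0 k = span k {![1, 0, 0, 0], ![0, 1, 0, 0]} := by
    have h0 : e k 0 = ![1, 0, 0, 0] := by ext i; fin_cases i <;> simp [e]
    have h1 : e k 1 = ![0, 1, 0, 0] := by ext i; fin_cases i <;> simp [e]
    rw [l0, h0, h1]
  rw [h, chi_span_pair]
  · simp
  · exact fun h => by simpa using congrFun h 0
  · intro h
    obtain ⟨d, hd⟩ := mem_span_singleton.mp h
    simpa using congrFun hd 1

theorem one_eq_chi_l0_add : (1 : Pt k → ZMod 2) = chi k (l0 k) +
    ∑ i : k × k, ptInd k ![i.1, i.2, 1, 0] +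
    ∑ i : k × k × k, ptInd k ![i.1, i.2.1, i.2.2, 1] := by
  have h1 : chi k (LinearMap.ker (LinearMap.proj 3 : (Fin 4 → k) →ₗ[k] k)) =
      chi k (l0 k) + ∑ i : k × k, ptInd k ![i.1, i.2, 1, 0] := by
    refine chi_eq_add_sum (fun i : k × k => ![i.1, i.2, 1, 0]) ?_ ?_ ?_ ?_ ?_
    · intro w hw; simpa using (mem_l0_iff.mp hw).2
    · intro i; simp
    · intro i; simp [mem_l0_iff]
    · intro w hw hw0
      have h3 : w 3 = 0 := by simpa using hw
      have h2 : w 2 ≠ 0 := fun h => hw0 (mem_l0_iff.mpr ⟨h, h3⟩)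
      refine ⟨w 2, (w 0 / w 2, w 1 / w 2), ?_⟩
      ext i; fin_cases i <;> simp [h3, mul_div_cancel₀ _ h2]
    · rintro ⟨a, b⟩ ⟨a', b'⟩ c h
      have hc : c = 1 := by simpa using (congrFun h 2).symm
      subst hc
      have := congrFun h 0
      have := congrFun h 1
      simp_all
  have h2 : chi k ⊤ = chi k (LinearMap.ker (LinearMap.proj 3 : (Fin 4 → k) →ₗ[k] k)) +
      ∑ i : k × k × k, ptInd k ![i.1, i.2.1, i.2.2, 1] := by
    refine chi_eq_add_sum (fun i : k × k × k => ![i.1, i.2.1, i.2.2, 1]) le_top ?_ ?_ ?_ ?_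
    · intro i; trivial
    · intro i; simp
    · intro w _ hw0
      have h3 : w 3 ≠ 0 := by simpa using hw0
      refine ⟨w 3, (w 0 / w 3, w 1 / w 3, w 2 / w 3), ?_⟩
      ext i; fin_cases i <;> simp [mul_div_cancel₀ _ h3]
    · rintro ⟨a, b, d⟩ ⟨a', b', d'⟩ c h
      have hc : c = 1 := by simpa using (congrFun h 3).symm
      subst hc
      have := congrFun h 0
      have := congrFun h 1
      have := congrFun h 2
      simp_all
  rw [← h1, ← h2]
  ext p; simp [chi]

omit [Fintype k] in
theorem skewLine_mem_L1 (a b c : k) : skewLine a b c ∈ L1 k := by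
  refine ⟨isLn_span_pair (skewLine_indep a b c).1 (skewLine_indep a b c).2 ?_, ?_⟩
  · simp [B]
  · rw [eq_bot_iff]
    rintro w ⟨hw, hw0⟩
    obtain ⟨d, d', rfl⟩ := mem_span_pair.mp hw
    obtain ⟨h2, h3⟩ := mem_l0_iff.mp hw0
    have h2' : d = 0 := by simpa using h2
    have h3' : d' = 0 := by simpa using h3
    simp [h2', h3']

omit [Fintype k] in
theorem isLn_baseLine (b : k) : IsLn k (baseLine b) :=
  isLn_span_pair (baseLine_indep b).1 (baseLine_indep b).2 (by simp [B])

omit [Fintype k] in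
theorem baseLine_ne_l0 (b : k) : baseLine b ≠ l0 k := by
  intro h
  have : (![0, b, 1, 0] : Fin 4 → k) ∈ l0 k := by rw [← h]; exact subset_span (by simp)
  simpa using (mem_l0_iff.mp this).1

omit [Fintype k] in
theorem secantLine_ne_l0 (β x : k) : secantLine β x ≠ l0 k := by
  intro h
  have : (![x, 0, β, 1] : Fin 4 → k) ∈ l0 k := by rw [← h]; exact subset_span (by simp)
  simpa using (mem_l0_iff.mp this).2

omit [Fintype k] in
theorem isLn_secantLine [CharP k 2] (β x : k) : IsLn k (secantLine β x) :=
  isLn_span_pair (secantLine_indep β x).1 (secantLine_indep β x).2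
    (by simp [B, CharTwo.add_self_eq_zero])

omit [Fintype k] in
theorem exists_eq_secantLine [CharP k 2] {m : Submodule k (Fin 4 → k)} (hm : IsLn k m)
    (hne : m ≠ l0 k) {β : k} (hβ : ![β, 1, 0, 0] ∈ m) : ∃ x, m = secantLine β x := by
  obtain ⟨w, hw, hw0⟩ : ∃ w ∈ m, w ∉ l0 k := by
    by_contra! h
    exact hne (Submodule.eq_of_le_of_finrank_eq h (by rw [hm.1, finrank_l0]))
  have hB : β * w 3 + w 2 = 0 := by simpa [B] using hm.2 _ hβ _ hw
  have h2 : w 2 = β * w 3 := (CharTwo.add_eq_zero.mp hB).symm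
  have h3 : w 3 ≠ 0 := fun h => hw0 (mem_l0_iff.mpr ⟨by rw [h2, h, mul_zero], h⟩)
  refine ⟨(w 0 - w 1 * β) / w 3, (Submodule.eq_of_le_of_finrank_eq ?_ ?_).symm⟩
  · rw [secantLine, span_le]
    rintro v (rfl | rfl)
    · exact hβ
    · have : (![(w 0 - w 1 * β) / w 3, 0, β, 1] : Fin 4 → k) =
          (w 3)⁻¹ • (w - w 1 • ![β, 1, 0, 0]) := by
        ext i; fin_cases i <;> simp <;> field_simp <;>
            simp [Matrix.vecHead, Matrix.vecTail, h2]
      rw [this]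
      exact smul_mem _ _ (sub_mem hw (smul_mem _ _ hβ))
  · rw [(isLn_secantLine β _).1, hm.1]

theorem map_chi_secantLine_eq [CharP k 2] {t : ℕ} (ht : 0 < t) (hcard : Fintype.card k = 2 ^ t)
    (φ : (Pt k → ZMod 2) →ₗ[ZMod 2] ZMod 2) (hφ : ∀ l ∈ L1 k, φ (chi k l) = 0) (β x x' : k) :
    φ (chi k (secantLine β x)) = φ (chi k (secantLine β x')) := by
  let ψ : ZMod 2 →+* k := ZMod.castHom (dvd_refl 2) k
  let f : k → k → k → ZMod 2 := fun y z s => φ (ptInd k ![z + y * s, y, s, 1])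
  have hline : ∀ a b c, ∑ s : k, f (a + b * s) (c + b * s ^ 2) s = φ (ptInd k ![a, b, 1, 0]) := by
    intro a b c
    have h := hφ _ (skewLine_mem_L1 a b c)
    rw [chi_skewLine, map_add, map_sum, CharTwo.add_eq_zero] at h
    rw [h]
    refine Finset.sum_congr rfl fun s _ => ?_
    simp only [f]
    have h1 : c + b * s ^ 2 + (a + b * s) * s = c + s * a := by
      linear_combination CharTwo.add_self_eq_zero (b * s ^ 2)
    rw [h1, mul_comm b s]
  have hF := fiber_sum_const ht hcard (fun y z s => ψ (f y z (s + β)))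
    (fun y z s => by
      rw [← map_pow]
      congr 1
      generalize f y z (s + β) = v
      revert v; decide)
    (fun a b c c' => by
      have h : ∀ c, ∑ s : k, f (a + b * s) (c + b * s ^ 2) (s + β) =
          φ (ptInd k ![a + b * β, b, 1, 0]) := by
        intro c
        rw [← hline (a + b * β) b (c + b * β ^ 2)]
        refine Fintype.sum_equiv (Equiv.addRight β) _ _ fun s => ?_
        simp only [Equiv.coe_addRight]
        congr 1
        · linear_combination (-b * β) * CharTwo.two_eq_zero (R := k)
        · linear_combination (-b * β ^ 2 - b * s * β) * CharTwo.two_eq_zero (R := k)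
      simp only [← map_sum, h])
    x x'
  simp only [← map_sum, zero_add] at hF
  have hinj := ψ.injective hF
  rw [chi_secantLine, chi_secantLine, map_add, map_add, map_sum, map_sum]
  exact congrArg _ hinj

theorem sum_const_eq_zero [CharP k 2] (g : Pt k → ZMod 2) : ∑ _i : k, g = 0 := by
  rw [Finset.sum_const, Finset.card_univ]
  have h : ((Fintype.card k : ℕ) : ZMod 2) = 0 := by
    rw [ZMod.natCast_eq_zero_iff, ← CharP.cast_eq_zero_iff k 2]
    exact FiniteField.cast_card_eq_zero k
  ext p
  simp [h]

theorem chi_l0_eq_sum [CharP k 2] : chi k (l0 k) = chi k (baseLine 0) +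
    ∑ β : k, chi k (secantLine β 0) + ∑ a : k, chi k (skewLine a 0 0) := by
  have h2 : ∀ g : Pt k → ZMod 2, g + g = 0 := fun g => by
    ext p; exact CharTwo.add_self_eq_zero _
  simp only [chi_baseLine, chi_secantLine, chi_skewLine, Finset.sum_add_distrib, chi_l0]
  have hc : ∑ β : k, ∑ y : k, ptInd k ![0 + y * β, y, β, 1] =
      ∑ a : k, ∑ s : k, ptInd k ![0 + s * a, a + s * 0, s, 1] := by
    rw [Finset.sum_comm]
    simp [mul_comm]
  rw [hc]
  generalize ∑ a : k, ∑ s : k, ptInd k ![0 + s * a, a + s * 0, s, 1] = g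
  generalize ∑ a : k, ptInd k ![a, 0, 1, 0] = g'
  linear_combination (exp := 1) -h2 g - h2 g'

theorem one_eq_sum [CharP k 2] : (1 : Pt k → ZMod 2) = chi k (l0 k) +
    ∑ b : k, chi k (baseLine b) + ∑ β : k, ∑ x : k, chi k (secantLine β x) := by
  rw [one_eq_chi_l0_add]
  congr 1
  · congr 1
    simp only [chi_baseLine, Finset.sum_add_distrib, sum_const_eq_zero, zero_add]
    rw [Fintype.sum_prod_type, Finset.sum_comm]
  · simp only [chi_secantLine, Finset.sum_add_distrib, sum_const_eq_zero, zero_add]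
    have : ∀ β : k, ∑ x : k, ∑ y : k, ptInd k ![x + y * β, y, β, 1] =
        ∑ x : k, ∑ y : k, ptInd k ![x, y, β, 1] := by
      intro β
      rw [Finset.sum_comm, Finset.sum_comm (f := fun x y => ptInd k ![x, y, β, 1])]
      refine Finset.sum_congr rfl fun y _ => ?_
      exact Fintype.sum_equiv (Equiv.addRight (y * β)) _ _ fun x => rfl
    simp only [this, Fintype.sum_prod_type]
    symm
    rw [Finset.sum_comm]
    exact Finset.sum_congr rfl fun x _ => Finset.sum_comm

end Geometry

theorem span_X0_Y_L1_contains_lines_and_one (t : ℕ) (ht : 0 < t) (q : ℕ)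
    (hq : q = 2 ^ t) (hcard : Fintype.card k = q)
    -- `Y`: for each point `p ≠ p0` on `ℓ0`, a chosen line `ℓ_p ∈ L \ {ℓ0}` through `p`
    (lsel : Pt k → Submodule k (Fin 4 → k))
    (hsel : ∀ p : Pt k, (p : Submodule k (Fin 4 → k)) ≤ l0 k →
      (p : Submodule k (Fin 4 → k)) ≠ p0 k →
      IsLn k (lsel p) ∧ lsel p ≠ l0 k ∧ (p : Submodule k (Fin 4 → k)) ≤ lsel p)
    (Y : Set (Pt k → ZMod 2))
    (hY : Y = (fun p => chi k (lsel p)) ''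
      {p : Pt k | (p : Submodule k (Fin 4 → k)) ≤ l0 k ∧
        (p : Submodule k (Fin 4 → k)) ≠ p0 k}) :
    (∀ l : Submodule k (Fin 4 → k), IsLn k l → l ≠ l0 k →
      chi k l ∈ span (ZMod 2) (X0 k ∪ Y ∪ chi k '' L1 k)) ∧
    (1 : Pt k → ZMod 2) ∈ span (ZMod 2) (X0 k ∪ Y ∪ chi k '' L1 k) := by
  subst hq
  have : CharP k 2 := charP_of_card_eq_prime_pow hcard
  set S := span (ZMod 2) (X0 k ∪ Y ∪ chi k '' L1 k) with hS
  have hlines : ∀ l : Submodule k (Fin 4 → k), IsLn k l → l ≠ l0 k → chi k l ∈ S := by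
    intro l hl hne
    by_cases hbot : l ⊓ l0 k = ⊥
    · exact subset_span (Or.inr ⟨l, ⟨hl, hbot⟩, rfl⟩)
    by_cases hp : p0 k ≤ l
    · exact subset_span (Or.inl (Or.inl ⟨⟨l, ⟨hl, hp⟩, rfl⟩, fun h => hne (chi_injective h)⟩))
    obtain ⟨w, ⟨hwl, hw0⟩, hw⟩ := (Submodule.ne_bot_iff _).mp hbot
    obtain ⟨h2, h3⟩ := mem_l0_iff.mp hw0
    have h1 : w 1 ≠ 0 := by
      intro h1
      have hwe : w = w 0 • e k 0 := by
        ext i; fin_cases i <;> simp [e, h1, h2, h3]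
      have h0 : w 0 ≠ 0 := fun h => hw (by rw [hwe, h, zero_smul])
      refine hp ?_
      rw [p0, span_singleton_le_iff_mem]
      exact (Submodule.smul_mem_iff _ h0).mp (hwe ▸ hwl)
    have hβ : (![w 0 / w 1, 1, 0, 0] : Fin 4 → k) ∈ l := by
      have : (![w 0 / w 1, 1, 0, 0] : Fin 4 → k) = (w 1)⁻¹ • w := by
        ext i; fin_cases i <;> simp [h1, h2, h3, div_eq_inv_mul]
      rw [this]
      exact smul_mem _ _ hwl
    generalize w 0 / w 1 = β at hβ
    obtain ⟨x, rfl⟩ := exists_eq_secantLine hl hne hβ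
    let p : Pt k := ⟨span k {![β, 1, 0, 0]}, finrank_span_singleton (secantLine_indep β 0).1⟩
    have hpl0 : (p : Submodule k (Fin 4 → k)) ≤ l0 k := by
      rw [span_singleton_le_iff_mem, mem_l0_iff]; simp
    have hpp0 : (p : Submodule k (Fin 4 → k)) ≠ p0 k := by
      intro h
      have : (![β, 1, 0, 0] : Fin 4 → k) ∈ p0 k := h ▸ mem_span_singleton_self _
      obtain ⟨c, hc⟩ := mem_span_singleton.mp this
      simpa [e] using congrFun hc 1
    obtain ⟨hm, hmne, hpm⟩ := hsel p hpl0 hpp0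
    obtain ⟨x', hx'⟩ := exists_eq_secantLine hm hmne (hpm (mem_span_singleton_self _))
    by_contra hnot
    obtain ⟨φ, hφ, hker⟩ := Submodule.exists_le_ker_of_notMem hnot
    refine hφ ?_
    rw [map_chi_secantLine_eq ht hcard φ
      (fun m hm => hker (subset_span (Or.inr ⟨m, hm, rfl⟩))) β x x', ← hx']
    refine hker (subset_span (Or.inl (Or.inr ?_)))
    rw [hY]
    exact ⟨p, ⟨hpl0, hpp0⟩, rfl⟩
  refine ⟨hlines, ?_⟩
  have hbase : ∀ b, chi k (baseLine b) ∈ S := fun b =>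
    hlines _ (isLn_baseLine b) (baseLine_ne_l0 b)
  have hsec : ∀ β x, chi k (secantLine β x) ∈ S := fun β x =>
    hlines _ (isLn_secantLine β x) (secantLine_ne_l0 β x)
  have hskew : ∀ a b c, chi k (skewLine a b c) ∈ S := fun a b c =>
    subset_span (Or.inr ⟨_, skewLine_mem_L1 a b c, rfl⟩)
  rw [one_eq_sum, chi_l0_eq_sum]
  exact add_mem (add_mem (add_mem (add_mem (hbase 0) (sum_mem fun β _ => hsec β 0))
    (sum_mem fun a _ => hskew a 0 0)) (sum_mem fun b _ => hbase b))
    (sum_mem fun β _ => sum_mem fun x _ => hsec β x)
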